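/- Let C be a K-coalgebra with coradical C₀ = ⊕_{i∈I} D^i, where the D^i are simple subcoalgebras of C. Then C₁/C₀ ≅ ⊕_{i,j∈I} (D^i ∧_C D^j)/(D^i + D^j); more precisely, C₁/C₀ is the internal direct sum of the subspaces ((D^i ∧_C D^j) + C₀)/C₀, and each of these is isomorphic to (D^i ∧_C D^j)/(D^i + D^j). -/

import Mathlib

open TensorProduct

noncomputable section
namespace DG

variable (K : Type*) [Field K] (C : Type*) [AddCommGroup C] [Module K C] [Coalgebra K C]

/-- The image of `D ⊗ E` inside `C ⊗ C`, for submodules `D E : Submodule K C`. -/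
def tsub (D E : Submodule K C) : Submodule K (C ⊗[K] C) :=
  LinearMap.range (TensorProduct.map D.subtype E.subtype)

/-- The wedge `D ∧_C E = {c | Δ c ∈ D ⊗ C + C ⊗ E}` of two subspaces of a coalgebra. -/
def wedge (D E : Submodule K C) : Submodule K C :=
  (tsub K C D ⊤ ⊔ tsub K C ⊤ E).comap (Coalgebra.comul : C →ₗ[K] C ⊗[K] C)

/-- A subspace `D` is a subcoalgebra if `Δ(D) ⊆ D ⊗ D`. -/
def IsSubcoalgebra (D : Submodule K C) : Prop :=
  ∀ x ∈ D, (Coalgebra.comul : C →ₗ[K] C ⊗[K] C) x ∈ tsub K C D D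

/-- A simple subcoalgebra: a nonzero subcoalgebra with no nonzero proper subcoalgebras. -/
def IsSimpleSubcoalgebra (D : Submodule K C) : Prop :=
  IsSubcoalgebra K C D ∧ D ≠ ⊥ ∧
    ∀ E : Submodule K C, IsSubcoalgebra K C E → E ≤ D → E = ⊥ ∨ E = D

/-- The coradical `C₀`: the sum of all simple subcoalgebras. -/
def coradical : Submodule K C := sSup {D | IsSimpleSubcoalgebra K C D}

/-- `C₁ = C₀ ∧_C C₀`, the second term of the coradical filtration. -/
def C1 : Submodule K C := wedge K C (coradical K C) (coradical K C)

section Coaction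

variable {K C}

omit [Coalgebra K C] in
lemma tsub_eq_map₂ (D E : Submodule K C) :
    tsub K C D E = Submodule.map₂ (TensorProduct.mk K C C) D E := by
  rw [tsub, TensorProduct.range_map, Submodule.range_subtype, Submodule.range_subtype]

omit [Coalgebra K C] in
lemma tsub_mono {D D' E E' : Submodule K C} (hD : D ≤ D') (hE : E ≤ E') :
    tsub K C D E ≤ tsub K C D' E' := by
  rw [tsub_eq_map₂, tsub_eq_map₂]
  exact Submodule.map₂_le_map₂ hD hE

lemma wedge_mono {D D' E E' : Submodule K C} (hD : D ≤ D') (hE : E ≤ E') :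
    wedge K C D E ≤ wedge K C D' E' :=
  Submodule.comap_mono (sup_le_sup (tsub_mono hD le_rfl) (tsub_mono le_rfl hE))

omit [Coalgebra K C] in
lemma map_tsub (f g : C →ₗ[K] C) (D E : Submodule K C) :
    (tsub K C D E).map (TensorProduct.map f g) = tsub K C (D.map f) (E.map g) := by
  rw [tsub, tsub, ← LinearMap.range_comp, TensorProduct.range_map, ← TensorProduct.map_comp,
    TensorProduct.range_map]
  simp [LinearMap.range_comp]

/-- The operator `c ↦ ∑ f(c₁) c₂` on a coalgebra attached to a functional `f`. -/
def coactL : (C →ₗ[K] K) →ₗ[K] C →ₗ[K] C where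
  toFun f := TensorProduct.lid K C ∘ₗ f.rTensor C ∘ₗ Coalgebra.comul
  map_add' f g := by ext; simp
  map_smul' a f := by ext; simp

/-- The operator `c ↦ ∑ f(c₂) c₁` on a coalgebra attached to a functional `f`. -/
def coactR : (C →ₗ[K] K) →ₗ[K] C →ₗ[K] C where
  toFun f := TensorProduct.rid K C ∘ₗ f.lTensor C ∘ₗ Coalgebra.comul
  map_add' f g := by ext; simp
  map_smul' a f := by ext; simp

lemma coactL_apply (f : C →ₗ[K] K) (c : C) :
    coactL f c = TensorProduct.lid K C (f.rTensor C (Coalgebra.comul c)) := rfl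

lemma coactR_apply (f : C →ₗ[K] K) (c : C) :
    coactR f c = TensorProduct.rid K C (f.lTensor C (Coalgebra.comul c)) := rfl

lemma coactL_counit : coactL (Coalgebra.counit : C →ₗ[K] K) = LinearMap.id := by
  ext c
  simp [coactL_apply]

lemma coactR_counit : coactR (Coalgebra.counit : C →ₗ[K] K) = LinearMap.id := by
  ext c
  simp [coactR_apply]

lemma comul_coactL (f : C →ₗ[K] K) (c : C) :
    (Coalgebra.comul (R := K) (coactL f c)) =
      TensorProduct.map (coactL f) LinearMap.id (Coalgebra.comul (R := K) c) := by
  have h : TensorProduct.map (coactL f) (LinearMap.id : C →ₗ[K] C) =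
      (TensorProduct.lid K (C ⊗[K] C)).toLinearMap ∘ₗ f.rTensor (C ⊗[K] C) ∘ₗ
        (TensorProduct.assoc K C C C).toLinearMap ∘ₗ Coalgebra.comul.rTensor C := by
    ext x y
    simp only [TensorProduct.AlgebraTensorModule.curry_apply, TensorProduct.curry_apply,
      LinearMap.coe_restrictScalars, TensorProduct.map_tmul, LinearMap.comp_apply,
      LinearMap.rTensor_tmul, coactL_apply, LinearMap.id_apply, LinearEquiv.coe_coe]
    induction Coalgebra.comul (R := K) x using TensorProduct.induction_on with
    | zero => simp
    | tmul a b => simp [TensorProduct.smul_tmul']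
    | add a b ha hb => simp [TensorProduct.add_tmul, ha, hb]
  rw [h]
  simp only [LinearMap.comp_apply, LinearEquiv.coe_coe, Coalgebra.coassoc_apply, coactL_apply]
  induction Coalgebra.comul (R := K) c using TensorProduct.induction_on with
  | zero => simp
  | tmul a b => simp
  | add a b ha hb => simp [ha, hb]

lemma comul_coactR (f : C →ₗ[K] K) (c : C) :
    (Coalgebra.comul (R := K) (coactR f c)) =
      TensorProduct.map LinearMap.id (coactR f) (Coalgebra.comul (R := K) c) := by
  have h : TensorProduct.map (LinearMap.id : C →ₗ[K] C) (coactR f) =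
      (TensorProduct.rid K (C ⊗[K] C)).toLinearMap ∘ₗ f.lTensor (C ⊗[K] C) ∘ₗ
        (TensorProduct.assoc K C C C).symm.toLinearMap ∘ₗ Coalgebra.comul.lTensor C := by
    ext x y
    simp only [TensorProduct.AlgebraTensorModule.curry_apply, TensorProduct.curry_apply,
      LinearMap.coe_restrictScalars, TensorProduct.map_tmul, LinearMap.comp_apply,
      LinearMap.lTensor_tmul, coactR_apply, LinearMap.id_apply, LinearEquiv.coe_coe]
    induction Coalgebra.comul (R := K) y using TensorProduct.induction_on with
    | zero => simp
    | tmul a b => simp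
    | add a b ha hb => simp [TensorProduct.tmul_add, ha, hb]
  rw [h]
  simp only [LinearMap.comp_apply, LinearEquiv.coe_coe, Coalgebra.coassoc_symm_apply,
    coactR_apply]
  induction Coalgebra.comul (R := K) c using TensorProduct.induction_on with
  | zero => simp
  | tmul a b => simp
  | add a b ha hb => simp [ha, hb]

lemma coactL_mem_of_comul_mem {D E : Submodule K C} {c : C} (f : C →ₗ[K] K)
    (h : Coalgebra.comul (R := K) c ∈ tsub K C D E) : coactL f c ∈ E := by
  rw [tsub_eq_map₂] at h
  have hle : Submodule.map₂ (TensorProduct.mk K C C) D E ≤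
      E.comap ((TensorProduct.lid K C).toLinearMap ∘ₗ f.rTensor C) :=
    Submodule.map₂_le.2 fun x _ y hy => by simpa using E.smul_mem (f x) hy
  exact hle h

lemma coactR_mem_of_comul_mem {D E : Submodule K C} {c : C} (f : C →ₗ[K] K)
    (h : Coalgebra.comul (R := K) c ∈ tsub K C D E) : coactR f c ∈ D := by
  rw [tsub_eq_map₂] at h
  have hle : Submodule.map₂ (TensorProduct.mk K C C) D E ≤
      D.comap ((TensorProduct.rid K C).toLinearMap ∘ₗ f.lTensor C) :=
    Submodule.map₂_le.2 fun x hx y _ => by simpa using D.smul_mem (f y) hx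
  exact hle h

lemma coactL_eq_zero_of_comul_mem {D E : Submodule K C} {c : C} {f : C →ₗ[K] K}
    (hf : D ≤ LinearMap.ker f) (h : Coalgebra.comul (R := K) c ∈ tsub K C D E) :
    coactL f c = 0 := by
  rw [tsub_eq_map₂] at h
  have hle : Submodule.map₂ (TensorProduct.mk K C C) D E ≤
      LinearMap.ker ((TensorProduct.lid K C).toLinearMap ∘ₗ f.rTensor C) :=
    Submodule.map₂_le.2 fun x hx y _ => by simp [LinearMap.mem_ker.1 (hf hx)]
  exact hle h

lemma coactR_eq_zero_of_comul_mem {D E : Submodule K C} {c : C} {f : C →ₗ[K] K}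
    (hf : E ≤ LinearMap.ker f) (h : Coalgebra.comul (R := K) c ∈ tsub K C D E) :
    coactR f c = 0 := by
  rw [tsub_eq_map₂] at h
  have hle : Submodule.map₂ (TensorProduct.mk K C C) D E ≤
      LinearMap.ker ((TensorProduct.rid K C).toLinearMap ∘ₗ f.lTensor C) :=
    Submodule.map₂_le.2 fun x _ y hy => by simp [LinearMap.mem_ker.1 (hf hy)]
  exact hle h

lemma coactL_mem_wedge {D E : Submodule K C} {c : C} (f : C →ₗ[K] K)
    (h : c ∈ wedge K C D E) : coactL f c ∈ wedge K C (D.map (coactL f)) E := by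
  have hle : tsub K C D ⊤ ⊔ tsub K C ⊤ E ≤
      (tsub K C (D.map (coactL f)) ⊤ ⊔ tsub K C ⊤ E).comap
        (TensorProduct.map (coactL f) LinearMap.id) := by
    rw [← Submodule.map_le_iff_le_comap, Submodule.map_sup, map_tsub, map_tsub, Submodule.map_id,
      Submodule.map_id]
    exact sup_le_sup le_rfl (tsub_mono le_top le_rfl)
  rw [wedge, Submodule.mem_comap, comul_coactL]
  exact hle h

lemma coactR_mem_wedge {D E : Submodule K C} {c : C} (f : C →ₗ[K] K)
    (h : c ∈ wedge K C D E) : coactR f c ∈ wedge K C D (E.map (coactR f)) := by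
  have hle : tsub K C D ⊤ ⊔ tsub K C ⊤ E ≤
      (tsub K C D ⊤ ⊔ tsub K C ⊤ (E.map (coactR f))).comap
        (TensorProduct.map LinearMap.id (coactR f)) := by
    rw [← Submodule.map_le_iff_le_comap, Submodule.map_sup, map_tsub, map_tsub, Submodule.map_id,
      Submodule.map_id]
    exact sup_le_sup (tsub_mono le_rfl le_top) le_rfl
  rw [wedge, Submodule.mem_comap, comul_coactR]
  exact hle h

omit [Coalgebra K C] in
lemma tsub_bot_left (E : Submodule K C) : tsub K C ⊥ E = ⊥ := by
  rw [tsub_eq_map₂, Submodule.map₂_bot_left]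

omit [Coalgebra K C] in
lemma tsub_bot_right (D : Submodule K C) : tsub K C D ⊥ = ⊥ := by
  rw [tsub_eq_map₂, Submodule.map₂_bot_right]

lemma wedge_bot_left (E : Submodule K C) : wedge K C ⊥ E ≤ E := by
  intro c hc
  rw [wedge, tsub_bot_left, bot_sup_eq] at hc
  simpa [coactL_counit] using coactL_mem_of_comul_mem Coalgebra.counit hc

lemma wedge_bot_right (D : Submodule K C) : wedge K C D ⊥ ≤ D := by
  intro c hc
  rw [wedge, tsub_bot_right, sup_bot_eq] at hc
  simpa [coactR_counit] using coactR_mem_of_comul_mem Coalgebra.counit hc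

lemma coactL_mem_of_mem_wedge {D E : Submodule K C} {c : C} {f : C →ₗ[K] K}
    (hf : D ≤ LinearMap.ker (coactL f)) (h : c ∈ wedge K C D E) : coactL f c ∈ E := by
  have := coactL_mem_wedge f h
  rw [le_bot_iff.1 (Submodule.map_le_iff_le_comap.2 hf)] at this
  exact wedge_bot_left E this

lemma coactR_mem_of_mem_wedge {D E : Submodule K C} {c : C} {f : C →ₗ[K] K}
    (hf : E ≤ LinearMap.ker (coactR f)) (h : c ∈ wedge K C D E) : coactR f c ∈ D := by
  have := coactR_mem_wedge f h
  rw [le_bot_iff.1 (Submodule.map_le_iff_le_comap.2 hf)] at this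
  exact wedge_bot_right D this

lemma exists_finset_mem_wedge_iSup {I : Type*} {D : I → Submodule K C} {c : C}
    (h : c ∈ wedge K C (⨆ i, D i) (⨆ i, D i)) :
    ∃ s : Finset I, c ∈ wedge K C (⨆ i ∈ s, D i) (⨆ i ∈ s, D i) := by
  classical
  obtain ⟨a, ha, b, hb, hab⟩ := Submodule.mem_sup.1 (Submodule.mem_comap.1 h)
  rw [tsub_eq_map₂, Submodule.map₂_iSup_left] at ha
  rw [tsub_eq_map₂, Submodule.map₂_iSup_right] at hb
  obtain ⟨s, hs⟩ := Submodule.mem_iSup_iff_exists_finset.1 ha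
  obtain ⟨t, ht⟩ := Submodule.mem_iSup_iff_exists_finset.1 hb
  refine ⟨s ∪ t, ?_⟩
  rw [wedge, Submodule.mem_comap, ← hab]
  refine Submodule.add_mem_sup ?_ ?_
  · refine (iSup₂_le fun i hi => ?_ : _ ≤ tsub K C _ _) hs
    rw [← tsub_eq_map₂]
    exact tsub_mono (le_iSup₂_of_le i (Finset.mem_union_left _ hi) le_rfl) le_rfl
  · refine (iSup₂_le fun i hi => ?_ : _ ≤ tsub K C _ _) ht
    rw [← tsub_eq_map₂]
    exact tsub_mono le_rfl (le_iSup₂_of_le i (Finset.mem_union_right _ hi) le_rfl)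

/-- Functionals restricting to the counit on one member of an independent family and to zero on
the others. -/
lemma exists_local_counit {I : Type*} {D : I → Submodule K C} (hD : iSupIndep D) (i : I) :
    ∃ f : C →ₗ[K] K, D i ≤ LinearMap.ker (Coalgebra.counit - f) ∧
      ∀ j ≠ i, D j ≤ LinearMap.ker f := by
  obtain ⟨E, hE, hc⟩ := (hD i).exists_isCompl
  refine ⟨Coalgebra.counit ∘ₗ E.subtype ∘ₗ E.projectionOnto _ hc, ?_, ?_⟩
  · intro x hx
    have := Submodule.projectionOnto_apply_left hc ⟨x, hE hx⟩
    rw [LinearMap.mem_ker, LinearMap.sub_apply, LinearMap.comp_apply, LinearMap.comp_apply, this]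
    simp
  · intro j hj x hx
    have hx' := (le_iSup₂_of_le j hj le_rfl : D j ≤ ⨆ j, ⨆ _ : j ≠ i, D j) hx
    rw [LinearMap.mem_ker, LinearMap.comp_apply, LinearMap.comp_apply,
      (Submodule.projectionOnto_apply_eq_zero_iff hc).2 hx']
    simp

end Coaction

/-- **Statement 9** (Theorem 4.1(iii)): if `C₀ = ⊕_{i ∈ I} Dⁱ` with `Dⁱ` simple subcoalgebras,
then `C₁/C₀` is the internal direct sum, over pairs `(i,j)`, of the images of the wedges
`Dⁱ ∧_C Dʲ` in `C/C₀`, and each such image is isomorphic to `(Dⁱ ∧_C Dʲ)/(Dⁱ + Dʲ)`;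
hence `C₁/C₀ ≅ ⊕_{i,j ∈ I} (Dⁱ ∧_C Dʲ)/(Dⁱ + Dʲ)`. -/
theorem C1_quot_direct_sum {K : Type*} [Field K] {C : Type*} [AddCommGroup C] [Module K C]
    [Coalgebra K C] {I : Type*} (D : I → Submodule K C)
    (hsimple : ∀ i, IsSimpleSubcoalgebra K C (D i))
    (hindep : iSupIndep D)
    (hsum : ⨆ i, D i = coradical K C) :
    iSupIndep (fun p : I × I => (wedge K C (D p.1) (D p.2)).map (coradical K C).mkQ) ∧
    (⨆ p : I × I, (wedge K C (D p.1) (D p.2)).map (coradical K C).mkQ) =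
      (C1 K C).map (coradical K C).mkQ ∧
    ∀ i j : I, Nonempty
      ((↥((wedge K C (D i) (D j)).map (coradical K C).mkQ)) ≃ₗ[K]
        (↥(wedge K C (D i) (D j)) ⧸
          Submodule.comap (wedge K C (D i) (D j)).subtype (D i ⊔ D j))) := by
  classical
  choose e he he0 using exists_local_counit hindep
  have hsub i : IsSubcoalgebra K C (D i) := (hsimple i).1
  have hC0 i : D i ≤ coradical K C := hsum ▸ le_iSup D i
  have hL0 {i j : I} (h : j ≠ i) : D j ≤ LinearMap.ker (coactL (e i)) :=
    fun x hx => coactL_eq_zero_of_comul_mem (he0 i j h) (hsub j x hx)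
  have hR0 {i j : I} (h : j ≠ i) : D j ≤ LinearMap.ker (coactR (e i)) :=
    fun x hx => coactR_eq_zero_of_comul_mem (he0 i j h) (hsub j x hx)
  have hL1 i : D i ≤ LinearMap.ker (coactL (Coalgebra.counit - e i)) :=
    fun x hx => coactL_eq_zero_of_comul_mem (he i) (hsub i x hx)
  have hR1 i : D i ≤ LinearMap.ker (coactR (Coalgebra.counit - e i)) :=
    fun x hx => coactR_eq_zero_of_comul_mem (he i) (hsub i x hx)
  have hLC0 (f : C →ₗ[K] K) : coradical K C ≤ (coradical K C).comap (coactL f) := by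
    conv_lhs => rw [← hsum]
    exact iSup_le fun i x hx => hC0 i (coactL_mem_of_comul_mem f (hsub i x hx))
  have hRC0 (f : C →ₗ[K] K) : coradical K C ≤ (coradical K C).comap (coactR f) := by
    conv_lhs => rw [← hsum]
    exact iSup_le fun i x hx => hC0 i (coactR_mem_of_comul_mem f (hsub i x hx))
  have hLi i : (coradical K C).map (coactL (e i)) ≤ D i := by
    rw [← hsum, Submodule.map_le_iff_le_comap]
    refine iSup_le fun j x hx => ?_
    by_cases hj : j = i
    · subst hj
      exact coactL_mem_of_comul_mem _ (hsub j x hx)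
    · simp [LinearMap.mem_ker.1 (hL0 hj hx)]
  have hRi i : (coradical K C).map (coactR (e i)) ≤ D i := by
    rw [← hsum, Submodule.map_le_iff_le_comap]
    refine iSup_le fun j x hx => ?_
    by_cases hj : j = i
    · subst hj
      exact coactR_mem_of_comul_mem _ (hsub j x hx)
    · simp [LinearMap.mem_ker.1 (hR0 hj hx)]
  have hLsub (f : C →ₗ[K] K) (c : C) : coactL (Coalgebra.counit - f) c = c - coactL f c := by
    simp [coactL_counit]
  have hRsub (f : C →ₗ[K] K) (c : C) : coactR (Coalgebra.counit - f) c = c - coactR f c := by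
    simp [coactR_counit]
  refine ⟨?_, le_antisymm ?_ ?_, fun i j => ?_⟩
  · let T (p : I × I) : (C ⧸ coradical K C) →ₗ[K] (C ⧸ coradical K C) :=
      (coradical K C).mapQ _ (coactL (e p.1) ∘ₗ coactR (e p.2))
        ((hRC0 _).trans (Submodule.comap_mono (hLC0 _)))
    have hT0 {p q : I × I} (h : q ≠ p) :
        (wedge K C (D q.1) (D q.2)).map (coradical K C).mkQ ≤ LinearMap.ker (T p) := by
      rintro _ ⟨w, hw, rfl⟩
      simp only [T, LinearMap.mem_ker, Submodule.mkQ_apply, Submodule.mapQ_apply,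
        LinearMap.comp_apply, Submodule.Quotient.mk_eq_zero]
      by_cases h2 : q.2 = p.2
      · have h1 : q.1 ≠ p.1 := fun h1 => h (Prod.ext h1 h2)
        have hmem := coactL_mem_of_mem_wedge (hL0 h1) (coactR_mem_wedge (e p.2) hw)
        obtain ⟨y, hy, hyw⟩ := hmem
        rw [← hyw]
        exact hRC0 _ (hC0 _ hy)
      · exact hLC0 _ (hC0 _ (coactR_mem_of_mem_wedge (hR0 h2) hw))
    have hT1 (p : I × I) (x) (hx : x ∈ (wedge K C (D p.1) (D p.2)).map (coradical K C).mkQ) :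
        T p x = x := by
      obtain ⟨w, hw, rfl⟩ := hx
      simp only [T, Submodule.mkQ_apply, Submodule.mapQ_apply, LinearMap.comp_apply]
      symm
      rw [Submodule.Quotient.eq]
      have h1 := coactL_mem_of_mem_wedge (hL1 p.1) hw
      have h2 := coactR_mem_of_mem_wedge (hR1 p.2) hw
      rw [hLsub] at h1
      rw [hRsub] at h2
      have h3 := hLC0 (e p.1) (hC0 _ h2)
      rw [Submodule.mem_comap, map_sub] at h3
      simpa using add_mem (hC0 _ h1) h3
    intro p
    rw [Submodule.disjoint_def]
    intro x hx hx'
    rw [← hT1 p x hx]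
    have hle : (⨆ q, ⨆ _ : q ≠ p, (wedge K C (D q.1) (D q.2)).map (coradical K C).mkQ) ≤
        LinearMap.ker (T p) := iSup₂_le fun q hq => hT0 hq
    exact hle hx'
  · exact iSup_le fun p => Submodule.map_mono (wedge_mono (hC0 _) (hC0 _))
  · rintro _ ⟨c, hc, rfl⟩
    have hc' := hc
    rw [C1, ← hsum] at hc'
    obtain ⟨s, hs⟩ := exists_finset_mem_wedge_iSup hc'
    have hsC0 : ⨆ i ∈ s, D i ≤ coradical K C := iSup₂_le fun i _ => hC0 i
    have hes i (hi : i ∈ s) : D i ≤ LinearMap.ker (Coalgebra.counit - ∑ k ∈ s, e k) := by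
      intro x hx
      have h1 := he i hx
      have h2 : ∑ k ∈ s, e k x = e i x :=
        Finset.sum_eq_single_of_mem i hi fun k _ hk => he0 k i hk.symm hx
      simpa [LinearMap.sum_apply, h2] using h1
    have hLs : ⨆ i ∈ s, D i ≤ LinearMap.ker (coactL (Coalgebra.counit - ∑ k ∈ s, e k)) :=
      iSup₂_le fun i hi x hx => coactL_eq_zero_of_comul_mem (hes i hi) (hsub i x hx)
    have hRs : ⨆ i ∈ s, D i ≤ LinearMap.ker (coactR (Coalgebra.counit - ∑ k ∈ s, e k)) :=
      iSup₂_le fun i hi x hx => coactR_eq_zero_of_comul_mem (hes i hi) (hsub i x hx)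
    have h1 := hsC0 (coactL_mem_of_mem_wedge hLs hs)
    have h2 := hsC0 (coactR_mem_of_mem_wedge hRs hs)
    rw [hLsub] at h1
    rw [hRsub] at h2
    have h3 := hLC0 (∑ k ∈ s, e k) h2
    rw [Submodule.mem_comap, map_sub] at h3
    have h4 : c - coactL (∑ k ∈ s, e k) (coactR (∑ k ∈ s, e k) c) ∈ coradical K C := by
      simpa using add_mem h1 h3
    rw [Submodule.mkQ_apply, (Submodule.Quotient.eq _).2 h4, ← Submodule.mkQ_apply]
    simp only [map_sum, LinearMap.sum_apply]
    refine sum_mem fun j _ => sum_mem fun i _ => ?_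
    refine Submodule.mem_iSup_of_mem (i, j) (Submodule.mem_map_of_mem ?_)
    exact wedge_mono (hLi _) (hRi _) (coactL_mem_wedge _ (coactR_mem_wedge _ hc))
  · have hker : LinearMap.ker ((coradical K C).mkQ ∘ₗ (wedge K C (D i) (D j)).subtype) =
        Submodule.comap (wedge K C (D i) (D j)).subtype (D i ⊔ D j) := by
      rw [LinearMap.ker_comp, Submodule.ker_mkQ]
      refine le_antisymm (fun x hx => ?_) (Submodule.comap_mono (sup_le (hC0 i) (hC0 j)))
      have h2 := coactR_mem_of_mem_wedge (hR1 j) x.2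
      rw [hRsub] at h2
      have h3 := hRi j (Submodule.mem_map_of_mem (Submodule.mem_comap.1 hx))
      simpa using Submodule.add_mem_sup h2 h3
    have hrange : LinearMap.range ((coradical K C).mkQ ∘ₗ (wedge K C (D i) (D j)).subtype) =
        (wedge K C (D i) (D j)).map (coradical K C).mkQ := by
      rw [LinearMap.range_comp, Submodule.range_subtype]
    exact ⟨((Submodule.quotEquivOfEq _ _ hker).symm ≪≫ₗ LinearMap.quotKerEquivRange _ ≪≫ₗ
      LinearEquiv.ofEq _ _ hrange).symm⟩

end DG
end
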